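/- Let K be an algebraically closed field of characteristic 0 and let d ≥ 4. Let L' ⊆ Sym^d be the K-span of {s^{d−1}·t, s^{d−2}·t², s^d + t^d}. Then for every Q = (α, β) ∈ K × K with (α, β) ≠ (0, 0), the value semigroup S(L', Q) is NOT finitely generated. In particular, for every integer d ≥ 4 there exists a rational plane curve of degree d whose homogeneous coordinate ring admits no Khovanskii-finite homogeneous valuation. (Example 4.10 of the paper, plane-curve claim, used for Theorem 1.4.) -/

import Mathlib

open MvPolynomial Filter

noncomputable section

variable {K : Type} [Field K]

/-- The linear form `β·s − α·t` in `K[s,t]`, cutting out the point `Q = (α : β)` of `ℙ¹`. -/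
def lform (α β : K) : MvPolynomial (Fin 2) K := C β * X 0 - C α * X 1

/-- The value semigroup `S(L, Q) = {(k, ord_Q f) : f ∈ L^k, f ≠ 0}` of the homogeneous
valuation `ν_Q` on `R(L) = ⨁ₖ L^k`, where `ord_Q f` is the largest `e` such that
`(β·s − α·t)^e` divides `f`. -/
def curveValueSemigroup (L : Submodule K (MvPolynomial (Fin 2) K)) (α β : K) :
    AddSubmonoid (ℤ × ℤ) :=
  AddSubmonoid.closure
    {p | ∃ (k e : ℕ) (f : MvPolynomial (Fin 2) K), f ∈ L ^ k ∧ f ≠ 0 ∧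
      (lform α β) ^ e ∣ f ∧ ¬ (lform α β) ^ (e + 1) ∣ f ∧ p = ((k : ℤ), (e : ℤ))}

/-- If `L` contains `s^{m+1}t`, `s^m t²` and `s^{m+2} + t^{m+2}`, then every monomial of degree
`(m + 2)k` that is divisible by `s^{mN}t^N` lies in `L^k`, as soon as `k ≥ N > m`. -/
theorem monomial_mem_pow_of_generators_mem {L : Submodule K (MvPolynomial (Fin 2) K)} {m N : ℕ}
    (hx : X 0 ^ (m + 1) * X 1 ∈ L) (hy : X 0 ^ m * X 1 ^ 2 ∈ L)
    (hz : X 0 ^ (m + 2) + X 1 ^ (m + 2) ∈ L) (hN : m < N) {k : ℕ} (hk : N ≤ k) :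
    ∀ i j : ℕ, m * N ≤ i → N ≤ j → i + j = (m + 2) * k →
      (X 0 ^ i * X 1 ^ j : MvPolynomial (Fin 2) K) ∈ L ^ k := by
  induction k, hk using Nat.le_induction with
  | base =>
    intro i j hi hj hij
    obtain ⟨b, rfl⟩ := Nat.exists_eq_add_of_le hj
    have hbN : b ≤ N := by nlinarith
    obtain ⟨a, rfl⟩ := Nat.exists_eq_add_of_le hbN
    obtain rfl : i = (m + 1) * a + m * b := by nlinarith
    have h := Submodule.mul_mem_mul (Submodule.pow_mem_pow L hx a) (Submodule.pow_mem_pow L hy b)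
    rw [← pow_add, add_comm a b] at h
    convert h using 1
    ring
  | succ k hk ih =>
    intro i j hi hj hij
    have hkN : (m + 2) * N ≤ (m + 2) * k := Nat.mul_le_mul_left _ hk
    rw [add_mul m 2 N] at hkN
    rw [mul_add, mul_one] at hij
    generalize m * N = A at *
    generalize (m + 2) * k = D at *
    have mulX : ∀ i j : ℕ, A + (m + 1) ≤ i → N + 1 ≤ j → i + j = D + (m + 2) →
        (X 0 ^ i * X 1 ^ j : MvPolynomial (Fin 2) K) ∈ L ^ (k + 1) := by
      intro i j hi hj hij
      obtain ⟨i, rfl⟩ := Nat.exists_eq_add_of_le' (le_of_add_le_right hi)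
      obtain ⟨j, rfl⟩ := Nat.exists_eq_add_of_le' (le_of_add_le_right hj)
      have h := Submodule.mul_mem_mul (ih i j (by omega) (by omega) (by omega)) hx
      rw [← pow_succ] at h
      convert h using 1
      ring
    have mulY : ∀ i j : ℕ, A + m ≤ i → N + 2 ≤ j → i + j = D + (m + 2) →
        (X 0 ^ i * X 1 ^ j : MvPolynomial (Fin 2) K) ∈ L ^ (k + 1) := by
      intro i j hi hj hij
      obtain ⟨i, rfl⟩ := Nat.exists_eq_add_of_le' (le_of_add_le_right hi)
      obtain ⟨j, rfl⟩ := Nat.exists_eq_add_of_le' (le_of_add_le_right hj)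
      have h := Submodule.mul_mem_mul (ih i j (by omega) (by omega) (by omega)) hy
      rw [← pow_succ] at h
      convert h using 1
      ring
    have mulZ : ∀ i j : ℕ, A ≤ i → N ≤ j → i + j = D →
        (X 0 ^ (i + (m + 2)) * X 1 ^ j + X 0 ^ i * X 1 ^ (j + (m + 2)) :
          MvPolynomial (Fin 2) K) ∈ L ^ (k + 1) := by
      intro i j hi hj hij
      have h := Submodule.mul_mem_mul (ih i j hi hj hij) hz
      rw [← pow_succ] at h
      convert h using 1
      ring
    rcases lt_or_ge i (A + (m + 1)) with hi' | hi'
    · obtain ⟨j, rfl⟩ : ∃ j', j = j' + (m + 2) := Nat.exists_eq_add_of_le' (by omega)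
      exact ((L ^ (k + 1)).add_mem_iff_right
        (mulX (i + (m + 2)) j (by omega) (by omega) (by omega))).1
        (mulZ i j hi (by omega) (by omega))
    · rcases lt_or_ge j (N + 1) with hj' | hj'
      · obtain ⟨i, rfl⟩ : ∃ i', i = i' + (m + 2) := Nat.exists_eq_add_of_le' (by omega)
        exact ((L ^ (k + 1)).add_mem_iff_left
          (mulY i (j + (m + 2)) (by omega) (by omega) (by omega))).1
          (mulZ i j (by omega) hj (by omega))
      · exact mulX i j hi' hj' hij

/-- A subspace containing all degree `D` monomials divisible by `s^a t^b` contains all degree `D`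
products of such a monomial with a power of a linear form. -/
theorem monomial_mul_lform_pow_mem {M : Submodule K (MvPolynomial (Fin 2) K)} {a b D : ℕ}
    (hM : ∀ i j : ℕ, a ≤ i → b ≤ j → i + j = D → X 0 ^ i * X 1 ^ j ∈ M) (α β : K) (n : ℕ) :
    ∀ i j : ℕ, a ≤ i → b ≤ j → i + j + n = D →
      X 0 ^ i * X 1 ^ j * lform α β ^ n ∈ M := by
  induction n with
  | zero => simpa using hM
  | succ n ih =>
    intro i j hi hj hij
    have h := M.sub_mem (M.smul_mem β (ih (i + 1) j (by omega) hj (by omega)))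
      (M.smul_mem α (ih i (j + 1) hi (by omega) (by omega)))
    convert h using 1
    simp only [MvPolynomial.smul_eq_C_mul]
    generalize hl : lform α β ^ n = l
    rw [pow_succ, hl, lform]
    ring

theorem pow_le_homogeneousSubmodule {L : Submodule K (MvPolynomial (Fin 2) K)} {d : ℕ}
    (hL : L ≤ homogeneousSubmodule (Fin 2) K d) (k : ℕ) :
    L ^ k ≤ homogeneousSubmodule (Fin 2) K (d * k) := by
  induction k with
  | zero =>
    rw [pow_zero, Submodule.one_le]
    exact isHomogeneous_one _ _
  | succ k ih =>
    rw [pow_succ, mul_add, mul_one]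
    exact (mul_le_mul' ih hL).trans (homogeneousSubmodule_mul _ _)

theorem lform_ne_zero {α β : K} (h : (α, β) ≠ (0, 0)) : lform α β ≠ 0 := by
  rintro h0
  apply h
  have h1 := congrArg (MvPolynomial.eval ![1, 0]) h0
  have h2 := congrArg (MvPolynomial.eval ![0, 1]) h0
  simp [lform] at h1 h2
  simp [h1, h2]

theorem totalDegree_lform {α β : K} (h : (α, β) ≠ (0, 0)) : (lform α β).totalDegree = 1 := by
  refine IsHomogeneous.totalDegree ?_ (lform_ne_zero h)
  refine IsHomogeneous.sub ?_ ?_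
  · simpa using (isHomogeneous_C (Fin 2) β).mul (isHomogeneous_X K 0)
  · simpa using (isHomogeneous_C (Fin 2) α).mul (isHomogeneous_X K 1)

theorem totalDegree_lform_pow_mul {α β : K} (h : (α, β) ≠ (0, 0)) (e : ℕ)
    {g : MvPolynomial (Fin 2) K} (hg : g ≠ 0) :
    (lform α β ^ e * g).totalDegree = e + g.totalDegree := by
  rw [totalDegree_mul_of_isDomain (pow_ne_zero _ (lform_ne_zero h)) hg]
  congr 1
  induction e with
  | zero => simp
  | succ e ih =>
    rw [pow_succ, totalDegree_mul_of_isDomain (pow_ne_zero _ (lform_ne_zero h)) (lform_ne_zero h),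
      ih, totalDegree_lform h]

/-- The order at a point of a nonzero form is at most its degree. -/
theorem le_of_lform_pow_dvd {α β : K} (h : (α, β) ≠ (0, 0)) {D e : ℕ}
    {f : MvPolynomial (Fin 2) K} (hf : f.IsHomogeneous D) (hf0 : f ≠ 0)
    (hdvd : lform α β ^ e ∣ f) : e ≤ D := by
  obtain ⟨g, rfl⟩ := hdvd
  have := hf.totalDegree hf0
  rw [totalDegree_lform_pow_mul h e (right_ne_zero_of_mul hf0)] at this
  omega

/-- A subspace containing a nonzero form of degree `D` with order `D` at a point contains the
`D`-th power of the linear form of that point. -/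
theorem lform_pow_mem_of_dvd {α β : K} (h : (α, β) ≠ (0, 0)) {D : ℕ}
    {M : Submodule K (MvPolynomial (Fin 2) K)} {f : MvPolynomial (Fin 2) K} (hfM : f ∈ M)
    (hf : f.IsHomogeneous D) (hf0 : f ≠ 0) (hdvd : lform α β ^ D ∣ f) : lform α β ^ D ∈ M := by
  obtain ⟨g, rfl⟩ := hdvd
  have hdeg := hf.totalDegree hf0
  have hg0 := right_ne_zero_of_mul hf0
  rw [totalDegree_lform_pow_mul h D hg0] at hdeg
  obtain ⟨c, rfl⟩ : ∃ c, g = C c := ⟨_, totalDegree_eq_zero_iff_eq_C.1 (by omega)⟩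
  have hc : c ≠ 0 := by
    rintro rfl
    simp at hg0
  rwa [mul_comm, ← smul_eq_C_mul, M.smul_mem_iff hc] at hfM

theorem pow_le_toSubmodule {R A : Type*} [CommSemiring R] [Semiring A] [Algebra R A]
    {L : Submodule R A} {S : Subalgebra R A} (hL : L ≤ Subalgebra.toSubmodule S) (k : ℕ) :
    L ^ k ≤ Subalgebra.toSubmodule S := by
  induction k with
  | zero =>
    rw [pow_zero, Submodule.one_le]
    exact S.one_mem
  | succ k ih =>
    rw [pow_succ, Submodule.mul_le]
    exact fun f hf g hg => S.mul_mem (ih hf) (hL hg)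

/-- No positive power of a linear form lies in a power of the span of `s^{m+1}t`, `s^m t²` and
`s^{m+2} + t^{m+2}`, for `m ≥ 2`: a polynomial in these three takes the same value at `(1, 0)` and
at `(0, 1)`, and its derivative along `s` vanishes at `(0, 1)`. -/
theorem lform_pow_notMem_span_pow [CharZero K] {α β : K} (h : (α, β) ≠ (0, 0)) {m : ℕ}
    (hm : 2 ≤ m) (k : ℕ) {n : ℕ} (hn : n ≠ 0) :
    lform α β ^ n ∉ (Submodule.span K
      ({X 0 ^ (m + 1) * X 1, X 0 ^ m * X 1 ^ 2, X 0 ^ (m + 2) + X 1 ^ (m + 2)} :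
        Set (MvPolynomial (Fin 2) K))) ^ k := by
  intro hmem
  let φ : MvPolynomial (Fin 2) K →ₐ[K] DualNumber K := aeval ![DualNumber.eps, 1]
  let ψ : MvPolynomial (Fin 2) K →ₐ[K] DualNumber K := aeval ![1, 0]
  have heps : ∀ r : ℕ, 2 ≤ r → (DualNumber.eps : DualNumber K) ^ r = 0 := fun r hr =>
    pow_eq_zero_of_le hr (by rw [sq, DualNumber.eps_mul_eps])
  have hspan : Submodule.span K
      ({X 0 ^ (m + 1) * X 1, X 0 ^ m * X 1 ^ 2, X 0 ^ (m + 2) + X 1 ^ (m + 2)} :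
        Set (MvPolynomial (Fin 2) K)) ≤ Subalgebra.toSubmodule (AlgHom.equalizer φ ψ) := by
    rw [Submodule.span_le]
    rintro f (rfl | rfl | rfl) <;>
      simp [φ, ψ, heps m hm, heps (m + 1) (by omega), heps (m + 2) (by omega)]
  have heq : φ (lform α β ^ n) = ψ (lform α β ^ n) := pow_le_toSubmodule hspan k hmem
  have hfst := congrArg TrivSqZeroExt.fst heq
  have hsnd := congrArg TrivSqZeroExt.snd heq
  simp only [φ, ψ, lform, map_pow, map_sub, map_mul, aeval_C, aeval_X,
    TrivSqZeroExt.algebraMap_eq_inl] at hfst hsnd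
  simp [hn] at hfst hsnd
  rcases hsnd with ⟨rfl, -⟩ | rfl
  · exact h (by simpa [hn, eq_comm] using hfst)
  · exact h (by simpa [hn] using hfst)

/-- A submonoid of `ℤ × ℤ` all of whose nonzero elements `(k, e)` have `k > 0` and `e < dk` is not
finitely generated if it has elements `(k, e)` with `k` arbitrarily large and `dk - e` bounded. -/
theorem not_fg_of_slope_lt {S : AddSubmonoid (ℤ × ℤ)} {d c : ℤ}
    (hlt : ∀ p ∈ S, p = 0 ∨ 0 < p.1 ∧ p.2 < d * p.1)
    (hsup : ∀ B : ℤ, ∃ p ∈ S, B < p.1 ∧ d * p.1 - c ≤ p.2) : ¬ S.FG := by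
  rintro ⟨G, rfl⟩
  obtain ⟨N, hN⟩ : ∃ N : ℕ, ∀ p ∈ G, p.1 ≤ N := by
    refine ⟨G.sup fun p => p.1.toNat, fun p hp => ?_⟩
    have := Finset.le_sup (f := fun p : ℤ × ℤ => p.1.toNat) hp
    omega
  have key : ∀ p ∈ AddSubmonoid.closure (G : Set (ℤ × ℤ)), p.1 ≤ N * (d * p.1 - p.2) := by
    intro p hp
    induction hp using AddSubmonoid.closure_induction with
    | mem p hp =>
      rcases hlt p (AddSubmonoid.subset_closure hp) with rfl | ⟨-, h⟩
      · simp
      · nlinarith [hN p hp]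
    | zero => simp
    | add p q _ _ hp hq =>
      simp only [Prod.fst_add, Prod.snd_add]
      linarith
  obtain ⟨p, hp, hB, hc⟩ := hsup (N * c)
  nlinarith [key p hp]

/-- **Example 4.10, plane-curve claim** (used for Theorem 1.4). Let `K` be an algebraically
closed field of characteristic `0`, `d ≥ 4`, and `L' ⊆ Sym^d` the span of
`{s^{d-1}·t, s^{d-2}·t², s^d + t^d}`. Then for every point `Q = (α : β)` of `ℙ¹`, the value
semigroup `S(L', Q)` is not finitely generated. In particular, for every `d ≥ 4` there is a
rational plane curve of degree `d` whose homogeneous coordinate ring admits no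
Khovanskii-finite homogeneous valuation. -/
theorem example410_planeCurve_not_khovanskiiFinite [IsAlgClosed K] [CharZero K]
    (d : ℕ) (hd : 4 ≤ d) :
    ∀ α β : K, (α, β) ≠ ((0 : K), (0 : K)) →
      ¬ (curveValueSemigroup
          (Submodule.span K
            ({X 0 ^ (d - 1) * X 1, X 0 ^ (d - 2) * X 1 ^ 2,
              X 0 ^ d + X 1 ^ d} : Set (MvPolynomial (Fin 2) K)))
          α β).FG := by
  intro α β h
  obtain ⟨m, rfl⟩ : ∃ m, d = m + 2 := Nat.exists_eq_add_of_le' (by omega)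
  have hm : 2 ≤ m := by omega
  rw [show m + 2 - 1 = m + 1 by omega, show m + 2 - 2 = m by omega]
  have hpow := fun k n hn => lform_pow_notMem_span_pow h hm k (n := n) hn
  generalize hL : Submodule.span K
    ({X 0 ^ (m + 1) * X 1, X 0 ^ m * X 1 ^ 2, X 0 ^ (m + 2) + X 1 ^ (m + 2)} :
      Set (MvPolynomial (Fin 2) K)) = L at hpow ⊢
  have hx : X 0 ^ (m + 1) * X 1 ∈ L := hL ▸ Submodule.subset_span (by simp)
  have hy : X 0 ^ m * X 1 ^ 2 ∈ L := hL ▸ Submodule.subset_span (by simp)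
  have hz : X 0 ^ (m + 2) + X 1 ^ (m + 2) ∈ L := hL ▸ Submodule.subset_span (by simp)
  have hhom : ∀ k, ∀ f ∈ L ^ k, f.IsHomogeneous ((m + 2) * k) := by
    refine fun k f hf => pow_le_homogeneousSubmodule (d := m + 2) ?_ k hf
    rw [← hL, Submodule.span_le]
    rintro f (rfl | rfl | rfl)
    · exact (isHomogeneous_X_pow 0 (m + 1)).mul (isHomogeneous_X K 1)
    · exact (isHomogeneous_X_pow 0 m).mul (isHomogeneous_X_pow 1 2)
    · exact (isHomogeneous_X_pow 0 (m + 2)).add (isHomogeneous_X_pow 1 (m + 2))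
  refine not_fg_of_slope_lt (d := (m + 2 : ℕ)) (c := (m * (m + 1) + (m + 1) : ℕ)) ?_ ?_
  · intro p hp
    induction hp using AddSubmonoid.closure_induction with
    | mem p hp =>
      obtain ⟨k, e, f, hf, hf0, hdvd, -, rfl⟩ := hp
      have hle := le_of_lform_pow_dvd h (hhom k f hf) hf0 hdvd
      rcases Nat.eq_zero_or_pos k with rfl | hk
      · left
        simpa using hle
      · right
        have hne : e ≠ (m + 2) * k := by
          rintro rfl
          exact hpow k _ (by positivity) (lform_pow_mem_of_dvd h hf (hhom k f hf) hf0 hdvd)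
        have hlt := lt_of_le_of_ne hle hne
        dsimp only
        exact ⟨by exact_mod_cast hk, by exact_mod_cast hlt⟩
    | zero => exact Or.inl rfl
    | add p q _ _ hp hq =>
      rcases hp with rfl | ⟨hp, hp'⟩
      · simpa using hq
      · rcases hq with rfl | ⟨hq, hq'⟩
        · simpa using Or.inr ⟨hp, hp'⟩
        · right
          simp only [Prod.fst_add, Prod.snd_add, mul_add]
          exact ⟨add_pos hp hq, add_lt_add hp' hq'⟩
  · intro B
    obtain ⟨k, hkB, hkm⟩ : ∃ k : ℕ, B < k ∧ m + 1 ≤ k :=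
      ⟨B.toNat + (m + 1), by push_cast; omega, by omega⟩
    obtain ⟨n, hn⟩ : ∃ n, (m + 2) * k = m * (m + 1) + (m + 1) + n :=
      Nat.exists_eq_add_of_le (by nlinarith)
    have hf := monomial_mul_lform_pow_mem
      (monomial_mem_pow_of_generators_mem hx hy hz (Nat.lt_succ_self m) hkm) α β n
      (m * (m + 1)) (m + 1) le_rfl le_rfl hn.symm
    have hf0 : X 0 ^ (m * (m + 1)) * X 1 ^ (m + 1) * lform α β ^ n ≠ 0 :=
      mul_ne_zero (mul_ne_zero (pow_ne_zero _ (X_ne_zero _)) (pow_ne_zero _ (X_ne_zero _)))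
        (pow_ne_zero _ (lform_ne_zero h))
    have hdvd := Dvd.intro_left _ (rfl : X 0 ^ (m * (m + 1)) * X 1 ^ (m + 1) * lform α β ^ n = _)
    generalize X 0 ^ (m * (m + 1)) * X 1 ^ (m + 1) * lform α β ^ n = f at hf hf0 hdvd
    have hfin : FiniteMultiplicity (lform α β) f := ⟨(m + 2) * k, fun hd' =>
      absurd (le_of_lform_pow_dvd h (hhom k f hf) hf0 hd') (by omega)⟩
    refine ⟨((k : ℤ), (multiplicity (lform α β) f : ℤ)), AddSubmonoid.subset_closure
      ⟨k, _, f, hf, hf0, pow_multiplicity_dvd _ _,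
        hfin.not_pow_dvd_of_multiplicity_lt (Nat.lt_succ_self _), rfl⟩, hkB, ?_⟩
    have hle := hfin.le_multiplicity_of_pow_dvd hdvd
    zify at hle hn
    push_cast
    linarith

end
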